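/- For every integer n ≥ 1 define G(n) = min{ k ≥ 0 : for every C∞-word u of length n there exists a word z over Σ with |z| ≤ k and uzu ∈ C^∞ }. Then G is well defined (the minimum exists for every n ≥ 1) and G(n) = o(n³), i.e., G(n)/n³ tends to 0 as n tends to infinity. -/

import Mathlib

/- Common framework: words over the alphabet Σ = {1,2} (represented as natural
numbers), run-length encoding, the derivative D, k-differentiable words C^k,
C∞-words, heights, roots, primitives, minimal/maximal words, simple extensions,
minimal forbidden words, and the left frontier Ψ. -/

namespace CinftyWords

/-- A word is a finite sequence of natural numbers. -/
abbrev Word := List ℕ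

/-- `w` is a word over the alphabet Σ = {1,2}. -/
def IsWord (w : Word) : Prop := ∀ x ∈ w, x = 1 ∨ x = 2

/-- Complement of a letter: exchanges 1 and 2. -/
def bar (x : ℕ) : ℕ := 3 - x

/-- Letterwise complement of a word. -/
def comp (w : Word) : Word := w.map bar

/-- Run-length encoding Δ: the sequence of lengths of maximal runs of equal
consecutive letters. -/
def rle (w : Word) : Word := (w.splitBy (· == ·)).map List.length

/-- Drop the first run if it has length 1. -/
def dropFirstRun1 (g : List (List ℕ)) : List (List ℕ) :=
  match g with
  | [] => []
  | r :: rs => if r.length = 1 then rs else r :: rs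

/-- The derivative `D w`: the run-length encoding of the word obtained from `w`
by deleting its first and/or last run when that run has length 1. -/
def D (w : Word) : Word :=
  ((dropFirstRun1 ((dropFirstRun1 (w.splitBy (· == ·))).reverse)).reverse).map List.length

/-- `w` is differentiable: `w` is a word over Σ and so is its run-length encoding. -/
def Diffble (w : Word) : Prop := IsWord w ∧ IsWord (rle w)

/-- The set C^k of k-differentiable words: `D^[j] w` is differentiable for all `j < k`
(so that `D^[k] w` is defined). -/
def CK (k : ℕ) : Set Word := {w | IsWord w ∧ ∀ j < k, Diffble (D^[j] w)}

/-- The set C∞ of words differentiable arbitrarily many times. -/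
def Cinf : Set Word := {w | ∀ k : ℕ, w ∈ CK k}

/-- The height of a C∞-word: the least `k` with `D^[k] w = []`. -/
noncomputable def height (w : Word) : ℕ := sInf {k | D^[k] w = []}

/-- The root of a C∞-word: `D^[height w - 1] w`. -/
noncomputable def root (w : Word) : Word := D^[height w - 1] w

/-- `v` is a primitive of `w`: `v` is differentiable and `D v = w`. -/
def IsPrimitive (v w : Word) : Prop := Diffble v ∧ D v = w

/-- A nonempty C∞-word is maximal if each `D^[j] w` (for `j ≤ height w - 2`) is a
primitive of `D^[j+1] w` of maximal length (vacuously true when `height w = 1`). -/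
def MaximalWord (w : Word) : Prop :=
  w ∈ Cinf ∧ w ≠ [] ∧ ∀ j, j + 2 ≤ height w →
    ∀ v, IsPrimitive v (D^[j + 1] w) → v.length ≤ (D^[j] w).length

/-- A nonempty C∞-word is minimal if each `D^[j] w` (for `j ≤ height w - 2`) is a
primitive of `D^[j+1] w` of minimal length (vacuously true when `height w = 1`). -/
def MinimalWord (w : Word) : Prop :=
  w ∈ Cinf ∧ w ≠ [] ∧ ∀ j, j + 2 ≤ height w →
    ∀ v, IsPrimitive v (D^[j + 1] w) → (D^[j] w).length ≤ v.length

/-- `w` is right maximal: a suffix of a maximal word. -/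
def RightMaximal (w : Word) : Prop := ∃ v, MaximalWord v ∧ w <:+ v

/-- `w` is left maximal: a prefix of a maximal word. -/
def LeftMaximal (w : Word) : Prop := ∃ v, MaximalWord v ∧ w <+: v

/-- `w` is right minimal: a suffix of a minimal word. -/
def RightMinimal (w : Word) : Prop := ∃ v, MinimalWord v ∧ w <:+ v

/-- `w` is left minimal: a prefix of a minimal word. -/
def LeftMinimal (w : Word) : Prop := ∃ v, MinimalWord v ∧ w <+: v

/-- `w` is right doubly extendable: both `w1` and `w2` are C∞-words. -/
def RightDoublyExt (w : Word) : Prop := w ++ [1] ∈ Cinf ∧ w ++ [2] ∈ Cinf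

/-- `w` is left doubly extendable: both `1w` and `2w` are C∞-words. -/
def LeftDoublyExt (w : Word) : Prop := 1 :: w ∈ Cinf ∧ 2 :: w ∈ Cinf

/-- `w` is fully extendable: `1w1`, `1w2`, `2w1`, `2w2` are all C∞-words. -/
def FullyExt (w : Word) : Prop :=
  ∀ x, (x = 1 ∨ x = 2) → ∀ y, (y = 1 ∨ y = 2) → x :: (w ++ [y]) ∈ Cinf

/-- `w'` is a right simple extension of `w`: `w' = w ++ s` is a C∞-word and at each
step the extension by the complementary letter is not a C∞-word. -/
def RightSimpleExt (w w' : Word) : Prop :=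
  w' ∈ Cinf ∧ ∃ s : Word, IsWord s ∧ w' = w ++ s ∧
    ∀ i < s.length, w ++ s.take i ++ [bar (s.getD i 0)] ∉ Cinf

/-- `w'` is a left simple extension of `w`. -/
def LeftSimpleExt (w w' : Word) : Prop := RightSimpleExt w.reverse w'.reverse

/-- `w'` is a simple extension of `w`: a right simple extension of a left simple
extension of `w`. -/
def SimpleExt (w w' : Word) : Prop := ∃ v, LeftSimpleExt w v ∧ RightSimpleExt v w'

/-- `m` is the maximal extension of `w`: a simple extension of `w` of maximal length. -/
def IsMaximalExtension (w m : Word) : Prop :=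
  SimpleExt w m ∧ ∀ v, SimpleExt w v → v.length ≤ m.length

/-- A language is factorial if it is closed under taking factors. -/
def Factorial (F : Set Word) : Prop := ∀ v ∈ F, ∀ u, u <:+: v → u ∈ F

/-- A language is anti-factorial if no word of it is a proper factor of another
word of it. -/
def AntiFactorial (M : Set Word) : Prop := ∀ u ∈ M, ∀ v ∈ M, u ≠ v → ¬ u <:+: v

/-- The set of minimal forbidden words of a (factorial) language `F`: words not
in `F` whose maximal proper prefix and maximal proper suffix are both in `F`. -/
def MF (F : Set Word) : Set Word := {v | v ∉ F ∧ v.dropLast ∈ F ∧ v.tail ∈ F}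

/-- The height of a minimal forbidden word of C∞: `k + 1`, where `k` is the
(unique) integer such that `w` is k-differentiable and `D^[k] w ∈ {111, 222}`. -/
noncomputable def MFheight (w : Word) : ℕ :=
  sInf {k | w ∈ CK k ∧ (D^[k] w = [1, 1, 1] ∨ D^[k] w = [2, 2, 2])} + 1

/-- The left frontier Ψ of a C∞-word: the word of length `height w` over {0,1,2}
recording the first letter of each derivative, with `2` replaced by `0` when the
first two letters of the previous derivative are distinct. -/
noncomputable def psi (w : Word) : List ℕ :=
  (List.range (height w)).map (fun i =>
    if i = 0 then w.getD 0 0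
    else if (D^[i] w).getD 0 0 = 2 ∧ (D^[i - 1] w).getD 0 0 ≠ (D^[i - 1] w).getD 1 0 then 0
    else (D^[i] w).getD 0 0)

end CinftyWords

open CinftyWords in
/-- The function `G(n)`: the minimal `k` such that every C∞-word `u` of length `n`
admits a word `z` over Σ with `|z| ≤ k` and `uzu ∈ C∞`. -/
noncomputable def G (n : ℕ) : ℕ :=
  sInf {k : ℕ | ∀ u ∈ CinftyWords.Cinf, u.length = n →
    ∃ z : CinftyWords.Word, CinftyWords.IsWord z ∧ z.length ≤ k ∧
      u ++ z ++ u ∈ CinftyWords.Cinf}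


namespace CinftyWords

/-- The letter of the alphabet `{1, 2}` coded by a Boolean. -/
def letter (c : Bool) : ℕ := if c then 2 else 1

theorem letter_mem (c : Bool) : letter c = 1 ∨ letter c = 2 := by cases c <;> decide

theorem letter_inj {c d : Bool} : letter c = letter d ↔ c = d := by
  cases c <;> cases d <;> decide

theorem exists_letter {a : ℕ} (h : a = 1 ∨ a = 2) : ∃ c, a = letter c := by
  rcases h with rfl | rfl
  exacts [⟨false, rfl⟩, ⟨true, rfl⟩]

/-- The word starting with `letter c` whose run lengths are the entries of `x`. -/
def integ : Bool → List ℕ → Word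
  | _, [] => []
  | c, a :: x => List.replicate a (letter c) ++ integ (!c) x

/-- The letter following `x` in a run structure that starts with the letter `c`. -/
def flips (c : Bool) (x : List ℕ) : Bool := c ^^ x.length.bodd

@[simp] theorem integ_nil (c : Bool) : integ c [] = [] := rfl

@[simp] theorem flips_nil (c : Bool) : flips c [] = c := by simp [flips]

@[simp] theorem flips_cons (c : Bool) (a : ℕ) (x : List ℕ) :
    flips c (a :: x) = flips (!c) x := by simp [flips]

theorem flips_append (c : Bool) (x y : List ℕ) : flips c (x ++ y) = flips (flips c x) y := by
  simp [flips]

@[simp] theorem flips_reverse (c : Bool) (x : List ℕ) : flips c x.reverse = flips c x := by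
  simp [flips]

theorem flips_not (c : Bool) (x : List ℕ) : flips (!c) x = !flips c x := by simp [flips]

@[simp] theorem flips_flips (c : Bool) (x : List ℕ) : flips (flips c x) x = c := by
  simp [flips]

theorem integ_append (c : Bool) (x y : List ℕ) :
    integ c (x ++ y) = integ c x ++ integ (flips c x) y := by
  induction x generalizing c with
  | nil => simp
  | cons a x ih => simp [integ, ih]

theorem integ_reverse (c : Bool) (x : List ℕ) :
    (integ c x).reverse = integ (!flips c x) x.reverse := by
  induction x generalizing c with
  | nil => simp
  | cons a x ih => simp [integ, integ_append, ih, flips_not]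

theorem length_integ (c : Bool) (x : List ℕ) : (integ c x).length = x.sum := by
  induction x generalizing c with
  | nil => rfl
  | cons a x ih => simp [integ, ih]

theorem isWord_integ (c : Bool) (x : List ℕ) : IsWord (integ c x) := by
  induction x generalizing c with
  | nil => simp [IsWord]
  | cons a x ih =>
    intro y hy
    rcases List.mem_append.1 hy with h | h
    · rw [List.eq_of_mem_replicate h]; exact letter_mem c
    · exact ih _ _ h

/-- The list of runs of `integ c x`. -/
def runs : Bool → List ℕ → List (List ℕ)
  | _, [] => []
  | c, a :: x => List.replicate a (letter c) :: runs (!c) x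

theorem flatten_runs (c : Bool) (x : List ℕ) : (runs c x).flatten = integ c x := by
  induction x generalizing c with
  | nil => rfl
  | cons a x ih => simp [runs, integ, ih]

theorem map_length_runs (c : Bool) (x : List ℕ) : (runs c x).map List.length = x := by
  induction x generalizing c with
  | nil => rfl
  | cons a x ih => simp [runs, ih]

theorem splitBy_integ (c : Bool) (x : List ℕ) (hx : ∀ a ∈ x, 0 < a) :
    (integ c x).splitBy (· == ·) = runs c x := by
  rw [← flatten_runs]
  apply List.splitBy_flatten
  · induction x generalizing c with
    | nil => simp [runs]
    | cons a x ih =>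
      have ha : 0 < a := hx a (by simp)
      have := ih (!c) fun b hb => hx b (by simp [hb])
      simp only [runs, List.mem_cons, not_or]
      exact ⟨by simp [eq_comm (a := ([] : List ℕ))]; omega, this⟩
  · clear hx
    induction x generalizing c with
    | nil => simp [runs]
    | cons a x ih =>
      simp only [runs, List.mem_cons, forall_eq_or_imp]
      refine ⟨?_, ih _⟩
      exact (List.isChain_replicate_of_rel a (by simp))
  · induction x generalizing c with
    | nil => simp [runs]
    | cons a x ih =>
      have := ih (!c) fun b hb => hx b (by simp [hb])
      rcases x with _ | ⟨b, x⟩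
      · simp [runs]
      · have ha : 0 < a := hx a (by simp)
        have hb : 0 < b := hx b (by simp)
        simp only [runs, List.isChain_cons_cons] at this ⊢
        refine ⟨⟨by simp; omega, by simp; omega, ?_⟩, this⟩
        simp [letter_inj]

theorem rle_integ (c : Bool) (x : List ℕ) (hx : ∀ a ∈ x, 0 < a) : rle (integ c x) = x := by
  rw [rle, splitBy_integ c x hx, map_length_runs]

/-- Every word is determined by its first letter and its run lengths. -/
theorem exists_integ {v : Word} (hv : IsWord v) :
    ∃ c x, (∀ a ∈ x, 0 < a) ∧ v = integ c x := by
  induction v with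
  | nil => exact ⟨true, [], by simp, rfl⟩
  | cons a v ih =>
    obtain ⟨d, x, hx, rfl⟩ := ih fun b hb => hv b (by simp [hb])
    obtain ⟨c, rfl⟩ := exists_letter (hv a (by simp))
    by_cases hcd : c = d
    · subst hcd
      rcases x with _ | ⟨m, t⟩
      · exact ⟨c, [1], by simp, by simp [integ]⟩
      · refine ⟨c, (m + 1) :: t, ?_, by simp [integ, List.replicate_succ]⟩
        simp only [List.mem_cons, forall_eq_or_imp] at hx ⊢
        exact ⟨by omega, hx.2⟩
    · refine ⟨c, 1 :: x, by simpa using hx, ?_⟩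
      have : (!c) = d := by cases c <;> cases d <;> simp_all
      simp [integ, this]

/-- Remove a leading `1`. -/
def trimLeft : List ℕ → List ℕ
  | [] => []
  | a :: x => if a = 1 then x else a :: x

/-- Remove a leading `1`, then a trailing `1`. -/
def trim (x : List ℕ) : List ℕ := (trimLeft (trimLeft x).reverse).reverse

theorem map_dropFirstRun1 (g : List (List ℕ)) :
    (dropFirstRun1 g).map List.length = trimLeft (g.map List.length) := by
  rcases g with _ | ⟨r, g⟩
  · rfl
  · simp only [dropFirstRun1, trimLeft, List.map_cons]
    split_ifs <;> simp

theorem D_eq_trim (w : Word) : D w = trim (rle w) := by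
  simp [D, trim, rle, map_dropFirstRun1]

theorem trim_reverse (x : List ℕ) : trim x.reverse = (trim x).reverse := by
  rcases x with _ | ⟨a, x⟩
  · rfl
  rcases List.eq_nil_or_concat x with rfl | ⟨y, b, rfl⟩
  · simp only [trim, trimLeft, List.reverse_cons, List.reverse_nil, List.nil_append]
    by_cases h : a = 1 <;> simp [h]
  · by_cases h : a = 1 <;> by_cases h' : b = 1 <;> simp [trim, trimLeft, h, h']

theorem trimLeft_suffix (x : List ℕ) : trimLeft x <:+ x := by
  rcases x with _ | ⟨a, x⟩
  · exact List.suffix_rfl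
  · simp only [trimLeft]
    split_ifs
    · exact List.suffix_cons _ _
    · exact List.suffix_rfl

theorem trim_factor (x : List ℕ) : trim x <:+: x := by
  have h : trim x <+: trimLeft x := by
    rw [← List.reverse_suffix]
    simpa [trim] using trimLeft_suffix (trimLeft x).reverse
  exact h.isInfix.trans (trimLeft_suffix x).isInfix

theorem trimLeft_mono {p q : List ℕ} (h : p <+: q) : trimLeft p <+: trimLeft q := by
  obtain ⟨r, rfl⟩ := h
  rcases p with _ | ⟨a, p⟩
  · simp [trimLeft]
  · simp only [trimLeft, List.cons_append]
    split_ifs <;> simp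

theorem IsWord.pos {w : Word} (h : IsWord w) : ∀ a ∈ w, 0 < a := fun a ha => by
  rcases h a ha with rfl | rfl <;> decide

theorem IsWord.of_factor {v w : Word} (h : IsWord w) (hv : v <:+: w) : IsWord v :=
  fun a ha => h a (hv.subset ha)

theorem diffble_integ {c : Bool} {x : List ℕ} (hx : IsWord x) : Diffble (integ c x) :=
  ⟨isWord_integ c x, by rw [rle_integ c x hx.pos]; exact hx⟩

theorem D_integ {c : Bool} {x : List ℕ} (hx : IsWord x) : D (integ c x) = trim x := by
  rw [D_eq_trim, rle_integ c x hx.pos]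

theorem Diffble.exists_integ {v : Word} (h : Diffble v) :
    ∃ c x, IsWord x ∧ v = integ c x := by
  obtain ⟨c, x, hx, rfl⟩ := CinftyWords.exists_integ h.1
  exact ⟨c, x, by simpa [rle_integ c x hx] using h.2, rfl⟩

theorem Diffble.reverse {v : Word} (h : Diffble v) :
    Diffble v.reverse ∧ D v.reverse = (D v).reverse := by
  obtain ⟨c, x, hx, rfl⟩ := h.exists_integ
  have hr : IsWord x.reverse := fun a ha => hx a (List.mem_reverse.1 ha)
  rw [integ_reverse]
  exact ⟨diffble_integ hr, by rw [D_integ hr, D_integ hx, trim_reverse]⟩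

theorem Diffble.of_cons {a : ℕ} {v : Word} (h : Diffble (a :: v)) :
    Diffble v ∧ D v <:+: D (a :: v) := by
  have key : ∀ {x y : List ℕ}, trimLeft x <:+ trimLeft y → trim x <:+: trim y := by
    intro x y hxy
    refine List.IsSuffix.isInfix ?_
    simpa [trim] using (trimLeft_mono hxy.reverse).reverse
  obtain ⟨d, x, hx, rfl⟩ := CinftyWords.exists_integ (v := v) fun b hb => h.1 b (by simp [hb])
  obtain ⟨c, rfl⟩ := exists_letter (h.1 a (by simp))
  rcases x with _ | ⟨m, t⟩
  · refine ⟨diffble_integ (by simp [IsWord]), ?_⟩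
    rw [D_integ (by simp [IsWord])]
    simp [trim, trimLeft]
  have hm : 0 < m := hx m (by simp)
  by_cases hcd : c = d
  · subst hcd
    have e : letter c :: integ c (m :: t) = integ c ((m + 1) :: t) := by
      simp [integ, List.replicate_succ]
    have hx' : ∀ b ∈ (m + 1) :: t, 0 < b := by
      simp only [List.mem_cons, forall_eq_or_imp] at hx ⊢
      exact ⟨by omega, hx.2⟩
    have hw : IsWord ((m + 1) :: t) := by
      have := h.2; rwa [e, rle_integ _ _ hx'] at this
    have hm1 : m = 1 := by
      have := hw (m + 1) (by simp); omega
    subst hm1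
    have hw1 : IsWord (1 :: t) := by
      intro b hb
      rcases List.mem_cons.1 hb with rfl | hb
      · simp
      · exact hw b (by simp [hb])
    refine ⟨diffble_integ hw1, ?_⟩
    rw [e, D_integ hw1, D_integ hw]
    exact key (by simp [trimLeft])
  · have e : letter c :: integ d (m :: t) = integ c (1 :: m :: t) := by
      have : (!c) = d := by cases c <;> cases d <;> simp_all
      simp [integ, this]
    have hw : IsWord (1 :: m :: t) := by
      have := h.2; rwa [e, rle_integ _ _ (by simpa using hx)] at this
    have hw1 : IsWord (m :: t) := hw.of_factor (List.suffix_cons _ _).isInfix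
    refine ⟨diffble_integ hw1, ?_⟩
    rw [e, D_integ hw1, D_integ hw]
    exact key (by simpa [trimLeft] using trimLeft_suffix (m :: t))

theorem Diffble.of_suffix {v w : Word} (h : Diffble w) (hv : v <:+ w) :
    Diffble v ∧ D v <:+: D w := by
  obtain ⟨s, rfl⟩ := hv
  induction s with
  | nil => exact ⟨h, List.infix_rfl⟩
  | cons a s ih =>
    have h1 := Diffble.of_cons (a := a) (v := s ++ v) h
    have h2 := ih h1.1
    exact ⟨h2.1, h2.2.trans h1.2⟩

theorem Diffble.of_factor {v w : Word} (h : Diffble w) (hv : v <:+: w) :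
    Diffble v ∧ D v <:+: D w := by
  obtain ⟨s, t, rfl⟩ := hv
  have h1 := (h.reverse.1).of_suffix (v := (s ++ v).reverse) (by simp)
  have h2 := h1.1.reverse
  have h4 := h1.2.reverse
  rw [h.reverse.2, List.reverse_reverse, ← h2.2, List.reverse_reverse] at h4
  rw [List.reverse_reverse] at h2
  have h3 := h2.1.of_suffix (v := v) (by simp)
  exact ⟨h3.1, h3.2.trans h4⟩

theorem mem_Cinf_iff {w : Word} : w ∈ Cinf ↔ ∀ j, Diffble (D^[j] w) := by
  constructor
  · intro h j
    exact (h (j + 1)).2 j (by omega)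
  · intro h k
    exact ⟨(h 0).1, fun j _ => h j⟩

theorem Cinf.diffble {w : Word} (h : w ∈ Cinf) : Diffble w := mem_Cinf_iff.1 h 0

theorem Cinf.deriv {w : Word} (h : w ∈ Cinf) : D w ∈ Cinf := by
  rw [mem_Cinf_iff] at h ⊢
  exact fun j => h (j + 1)

theorem Cinf.of_factor {v w : Word} (h : w ∈ Cinf) (hv : v <:+: w) : v ∈ Cinf := by
  rw [mem_Cinf_iff] at h ⊢
  have key : ∀ j, D^[j] v <:+: D^[j] w := by
    intro j
    induction j with
    | zero => exact hv
    | succ j ih =>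
      rw [Function.iterate_succ_apply', Function.iterate_succ_apply']
      exact ((h j).of_factor ih).2
  exact fun j => ((h j).of_factor (key j)).1

theorem integ_mem_Cinf {x : Word} (h : x ∈ Cinf) (c : Bool) : integ c x ∈ Cinf := by
  have hx := (Cinf.diffble h).1
  rw [mem_Cinf_iff]
  rintro (_ | j)
  · exact diffble_integ hx
  · rw [Function.iterate_succ_apply, D_integ hx]
    exact mem_Cinf_iff.1 (Cinf.of_factor h (trim_factor x)) j

theorem exists_integ_trimLeft (c : Bool) (x : List ℕ) :
    ∃ d pre, integ c x = pre ++ integ d (trimLeft x) ∧ (pre = [] ∨ pre = [letter !d]) := by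
  rcases x with _ | ⟨a, x⟩
  · exact ⟨c, [], rfl, .inl rfl⟩
  by_cases ha : a = 1
  · exact ⟨!c, [letter c], by simp [integ, trimLeft, ha], .inr (by simp)⟩
  · exact ⟨c, [], by simp [trimLeft, ha], .inl rfl⟩

theorem exists_integ_trimRight (c : Bool) (x : List ℕ) :
    ∃ post, integ c x = integ c (trimLeft x.reverse).reverse ++ post ∧
      (post = [] ∨ post = [letter (flips c (trimLeft x.reverse).reverse)]) := by
  rcases List.eq_nil_or_concat x with rfl | ⟨y, b, rfl⟩
  · exact ⟨[], rfl, .inl rfl⟩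
  by_cases hb : b = 1
  · exact ⟨[letter (flips c y)], by simp [integ, integ_append, trimLeft, hb],
      .inr (by simp [trimLeft, hb])⟩
  · exact ⟨[], by simp [trimLeft, hb], .inl rfl⟩

/-- A differentiable word is obtained from its derivative by integration, up to at most one letter
on each side. -/
theorem Diffble.eq_integ_D {u : Word} (h : Diffble u) :
    ∃ c pre post, u = pre ++ integ c (D u) ++ post ∧ (pre = [] ∨ pre = [letter !c]) ∧
      (post = [] ∨ post = [letter (flips c (D u))]) := by
  obtain ⟨d, x, hx, rfl⟩ := h.exists_integ
  obtain ⟨c, pre, h1, hpre⟩ := exists_integ_trimLeft d x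
  obtain ⟨post, h2, hpost⟩ := exists_integ_trimRight c (trimLeft x)
  rw [D_integ hx]
  exact ⟨c, pre, post, by rw [h1, h2, List.append_assoc, trim], hpre, hpost⟩

theorem IsWord.length_le_sum {x : Word} (hx : IsWord x) : x.length ≤ x.sum := by
  induction x with
  | nil => simp
  | cons a x ih =>
    have := ih (hx.of_factor (List.suffix_cons a x).isInfix)
    have := hx.pos a (by simp)
    simp only [List.length_cons, List.sum_cons]
    omega

theorem Diffble.length_D_lt {u : Word} (h : Diffble u) (hu : u ≠ []) :
    (D u).length < u.length := by
  obtain ⟨d, x, hx, rfl⟩ := h.exists_integ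
  rw [D_integ hx, length_integ]
  rcases x with _ | ⟨a, x⟩
  · exact absurd rfl hu
  have h1 : (trim (a :: x)).length ≤ (trimLeft (a :: x)).length := by
    simpa [trim] using (trimLeft_suffix (trimLeft (a :: x)).reverse).length_le
  have h2 := (hx.of_factor (List.suffix_cons a x).isInfix).length_le_sum
  rcases hx a (by simp) with rfl | rfl <;> simp [trimLeft] at h1 ⊢ <;> omega

/-- A differentiable word of length at least `3` contains a letter `2`. -/
theorem Diffble.length_lt_sum {e : Word} (h : Diffble e) (he : 3 ≤ e.length) :
    e.length < e.sum := by
  obtain ⟨c, x, hx, rfl⟩ := h.exists_integ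
  have hw := isWord_integ c x
  by_contra hlt
  have hone : ∀ {y : Word}, IsWord y → y.sum ≤ y.length → y = List.replicate y.length 1 := by
    intro y hy hs
    induction y with
    | nil => rfl
    | cons a y ih =>
      have hy' := hy.of_factor (List.suffix_cons a y).isInfix
      have := hy'.length_le_sum
      simp only [List.length_cons, List.sum_cons] at hs ⊢
      rcases hy a (by simp) with rfl | rfl
      · rw [List.replicate_succ, ← ih hy' (by omega)]
      · omega
  have h1 := hone hw (by omega)
  have h2 : List.replicate (integ c x).length 1 = integ false [(integ c x).length] := by
    simp [integ, letter]
  rw [h2] at h1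
  have h3 := h.2
  rw [h1, rle_integ _ _ (by simp; omega)] at h3
  have := h3 (integ c x).length (by simp)
  omega

/-- Iterated integration, along a list of first letters. -/
def lift : List Bool → List ℕ → Word
  | [], x => x
  | c :: s, x => lift s (integ c x)

/-- The list of first letters at the right end of an iterated integration. -/
def act : List Bool → List ℕ → List Bool
  | [], _ => []
  | c :: s, x => flips c x :: act s (integ c x)

theorem lift_append (s : List Bool) (x y : List ℕ) :
    lift s (x ++ y) = lift s x ++ lift (act s x) y := by
  induction s generalizing x y with
  | nil => rfl
  | cons c s ih => simp [lift, act, integ_append, ih]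

theorem act_append (s : List Bool) (x y : List ℕ) : act s (x ++ y) = act (act s x) y := by
  induction s generalizing x y with
  | nil => rfl
  | cons c s ih => simp [act, integ_append, ih, flips_append]

theorem length_act (s : List Bool) (x : List ℕ) : (act s x).length = s.length := by
  induction s generalizing x with
  | nil => rfl
  | cons c s ih => simp [act, ih]

theorem lift_reverse (s : List Bool) (x : List ℕ) :
    (lift s x).reverse = lift ((act s x).map not) x.reverse := by
  induction s generalizing x with
  | nil => rfl
  | cons c s ih => simp [lift, act, ih, integ_reverse]

theorem exists_act_eq (t : List Bool) (x : List ℕ) : ∃ s, s.length = t.length ∧ act s x = t := by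
  induction t generalizing x with
  | nil => exact ⟨[], rfl, rfl⟩
  | cons c t ih =>
    obtain ⟨s, hs, h⟩ := ih (integ (flips c x) x)
    exact ⟨flips c x :: s, by simp [hs], by simp [act, h]⟩

theorem lift_concat (s : List Bool) (c : Bool) (x : List ℕ) :
    lift (s ++ [c]) x = integ c (lift s x) := by
  induction s generalizing x with
  | nil => rfl
  | cons d s ih => simp [lift, ih]

theorem lift_mem_Cinf {x : Word} (h : x ∈ Cinf) (s : List Bool) : lift s x ∈ Cinf := by
  induction s generalizing x with
  | nil => exact h
  | cons c s ih => exact ih (integ_mem_Cinf h c)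

theorem diffble_lift {x : Word} (h : Diffble x) (s : List Bool) : Diffble (lift s x) := by
  induction s generalizing x with
  | nil => exact h
  | cons c s ih => exact ih (diffble_integ h.1)

theorem integ_extends {v e post : Word} {c : Bool} (hd : Diffble (v ++ e)) (he : 3 ≤ e.length)
    (hpost : post = [] ∨ post = [letter (flips c v)]) :
    ∃ e', integ c (v ++ e) = integ c v ++ post ++ e' ∧ 3 ≤ e'.length := by
  have hde := (hd.of_suffix (List.suffix_append v e)).1
  have hlt := hde.length_lt_sum he
  rw [integ_append]
  rcases hpost with rfl | rfl
  · exact ⟨_, by simp; rfl, by rw [length_integ]; omega⟩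
  rcases e with _ | ⟨a, e⟩
  · simp at he
  obtain ⟨m, rfl⟩ := Nat.exists_eq_succ_of_ne_zero (hde.1.pos a (by simp)).ne'
  refine ⟨List.replicate m (letter (flips c v)) ++ integ (!flips c v) e, ?_, ?_⟩
  · simp [integ, List.replicate_succ]
  · simp only [List.length_append, List.length_replicate, length_integ]
    simp only [List.length_cons, List.sum_cons] at hlt he
    omega

/-- Every word `u` with vanishing `H`-th derivative has a marked position and a list of letters such
that `u` occurs around that position in every `H`-fold primitive following these letters. -/
theorem exists_stack (H : ℕ) : ∀ u ∈ Cinf, D^[H] u = [] →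
    ∃ t ul ur, t.length = H ∧ u = ul.reverse ++ ur ∧ ∀ g, Diffble g → 3 ≤ g.length →
      (∃ e, lift t g = ur ++ e ∧ 3 ≤ e.length) ∧
      (∃ e, lift (t.map not) g = ul ++ e ∧ 3 ≤ e.length) := by
  induction H with
  | zero =>
    intro u _ hu
    exact ⟨[], [], [], rfl, by simpa using hu, fun g _ hg => ⟨⟨g, rfl, hg⟩, ⟨g, rfl, hg⟩⟩⟩
  | succ H ih =>
    intro u hu hH
    obtain ⟨t, ul, ur, ht, hD, hext⟩ := ih (D u) (Cinf.deriv hu) hH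
    obtain ⟨c, pre, post, hu', hpre, hpost⟩ := (Cinf.diffble hu).eq_integ_D
    refine ⟨t ++ [flips c ul], integ (!flips c ul) ul ++ pre, integ (flips c ul) ur ++ post,
      by simp [ht], ?_, ?_⟩
    · have hp : pre.reverse = pre := by rcases hpre with rfl | rfl <;> rfl
      rw [hu', hD, integ_append, List.reverse_append, integ_reverse, hp]
      simp [flips_not]
    · intro g hg hg3
      obtain ⟨⟨e, he, he3⟩, ⟨e', he', he3'⟩⟩ := hext g hg hg3
      rw [List.map_append, lift_concat, List.map_singleton, lift_concat, he, he']
      refine ⟨integ_extends (he ▸ diffble_lift hg t) he3 ?_,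
        integ_extends (he' ▸ diffble_lift hg _) he3' ?_⟩
      · rwa [hD, flips_append, flips_reverse] at hpost
      · rwa [flips_not, flips_flips]

/-- A word with vanishing `H`-th derivative has two occurrences without overlap in some `H`-fold
primitive of any given sufficiently long `C∞`-word. -/
theorem exists_return {H : ℕ} {u X : Word} (hu : u ∈ Cinf) (hH : D^[H] u = []) (hX : X ∈ Cinf)
    (hlen : X.length = 6 * 2 ^ H + 6) :
    ∃ s z, s.length = H ∧ u ++ z ++ u <:+: lift s X := by
  obtain ⟨t, ul, ur, ht, rfl, hext⟩ := exists_stack H u hu hH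
  choose σ hσl hσ using fun k : Fin (2 ^ H + 1) => exists_act_eq t (X.take (3 + 6 * k))
  obtain ⟨k, k', hkk, hs⟩ : ∃ k k', k < k' ∧ σ k = σ k' := by
    obtain ⟨k, k', hne, he⟩ := Fintype.exists_ne_map_eq_of_card_lt
      (β := List.Vector Bool H) (fun k => ⟨σ k, (hσl k).trans ht⟩) (by simp)
    have he' : σ k = σ k' := congrArg Subtype.val he
    rcases lt_or_gt_of_ne hne with h | h
    exacts [⟨k, k', h, he'⟩, ⟨k', k, h, he'.symm⟩]
  have hk' : (k' : ℕ) ≤ 2 ^ H := by omega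
  have hkk' : (k : ℕ) < k' := hkk
  obtain ⟨a, g, f, b, rfl, ha, hg, hf, hb, hσa, hσf⟩ : ∃ a g f b : Word, X = a ++ g ++ f ++ b ∧
      3 ≤ a.length ∧ 3 ≤ g.length ∧ 3 ≤ f.length ∧ 3 ≤ b.length ∧
      act (σ k) a = t ∧ act (σ k) (a ++ g ++ f) = t := by
    have h1 : X.take (3 + 6 * k') = X.take (3 + 6 * k) ++ (X.drop (3 + 6 * k)).take 3 ++
        (X.drop (3 + 6 * k + 3)).take (6 * k' - 6 * k - 3) := by
      rw [← List.take_add, ← List.take_add]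
      congr 1
      omega
    refine ⟨X.take (3 + 6 * k), (X.drop (3 + 6 * k)).take 3,
      (X.drop (3 + 6 * k + 3)).take (6 * k' - 6 * k - 3), X.drop (3 + 6 * k'), ?_, ?_, ?_, ?_, ?_,
      hσ k, ?_⟩
    · rw [← h1, List.take_append_drop]
    · simp only [List.length_take]; omega
    · simp only [List.length_take, List.length_drop]; omega
    · simp only [List.length_take, List.length_drop]; omega
    · simp only [List.length_drop]; omega
    · rw [← h1, hs, hσ k']
  have hd := Cinf.diffble hX
  have hda := (hd.of_factor (v := a) ⟨[], g ++ f ++ b, by simp⟩).1.reverse.1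
  have hdg := (hd.of_factor (v := g) ⟨a, f ++ b, by simp⟩).1
  have hdf := (hd.of_factor (v := f) ⟨a ++ g, b, by simp⟩).1.reverse.1
  have hdb := (hd.of_factor (v := b) ⟨a ++ g ++ f, [], by simp⟩).1
  obtain ⟨e₁, h₁, -⟩ := (hext _ hda (by simpa using ha)).2
  obtain ⟨e₂, h₂, -⟩ := (hext _ hdg hg).1
  obtain ⟨e₃, h₃, -⟩ := (hext _ hdf (by simpa using hf)).2
  obtain ⟨e₄, h₄, -⟩ := (hext _ hdb hb).1
  have r₁ := congrArg List.reverse (lift_reverse (σ k) a)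
  rw [hσa, h₁, List.reverse_reverse] at r₁
  have r₃ := congrArg List.reverse (lift_reverse (act (σ k) (a ++ g)) f)
  rw [← act_append, hσf, h₃, List.reverse_reverse] at r₃
  refine ⟨σ k, e₂ ++ e₃.reverse, (hσl k).trans ht, e₁.reverse, e₄, ?_⟩
  rw [lift_append, lift_append, lift_append, hσf, hσa, r₁, h₂, r₃, h₄]
  simp

/-- Potential of a list of four letters, used to balance the numbers of letters `1` and `2`. -/
def potential : List Bool → ℕ
  | [false, false, false, false] => 19
  | [false, false, false, true] => 0
  | [false, false, true, false] => 10
  | [false, false, true, true] => 3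
  | [false, true, false, false] => 28
  | [false, true, false, true] => 0
  | [false, true, true, false] => 11
  | [false, true, true, true] => 9
  | [true, false, false, false] => 7
  | [true, false, false, true] => 5
  | [true, false, true, false] => 26
  | [true, false, true, true] => 0
  | [true, true, false, false] => 25
  | [true, true, false, true] => 0
  | [true, true, true, false] => 16
  | [true, true, true, true] => 6
  | _ => 0

theorem potential_step (a b c d : Bool) :
    (11 * (lift [a, b, c, d] [1]).count 2 + potential [a, b, c, d] ≤
      13 * (lift [a, b, c, d] [1]).count 1 + potential (act [a, b, c, d] [1])) ∧
    (11 * (lift [a, b, c, d] [2]).count 2 + potential [a, b, c, d] ≤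
      13 * (lift [a, b, c, d] [2]).count 1 + potential (act [a, b, c, d] [2])) := by
  revert a b c d
  decide

theorem potential_le (s : List Bool) : potential s ≤ 28 := by
  unfold potential
  split <;> decide

theorem count_lift_add_potential {s : List Bool} (hs : s.length = 4) {x : Word} (hx : IsWord x) :
    11 * (lift s x).count 2 + potential s ≤ 13 * (lift s x).count 1 + potential (act s x) := by
  induction x generalizing s with
  | nil =>
    have h : ∀ s : List Bool, lift s [] = [] ∧ act s [] = s := by
      intro s
      induction s with
      | nil => exact ⟨rfl, rfl⟩
      | cons c s ih => exact ⟨ih.1, by simp [act, ih.2]⟩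
    simp [h]
  | cons y x ih =>
    obtain ⟨a, b, c, d, rfl⟩ : ∃ a b c d, s = [a, b, c, d] := by
      match s, hs with
      | [a, b, c, d], _ => exact ⟨a, b, c, d, rfl⟩
    have h1 := ih ((length_act _ [y]).trans hs) (hx.of_factor (List.suffix_cons y x).isInfix)
    have h2 : 11 * (lift [a, b, c, d] [y]).count 2 + potential [a, b, c, d] ≤
        13 * (lift [a, b, c, d] [y]).count 1 + potential (act [a, b, c, d] [y]) := by
      rcases hx y (by simp) with rfl | rfl
      exacts [(potential_step a b c d).1, (potential_step a b c d).2]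
    rw [← List.singleton_append (l := x), lift_append, act_append, List.count_append,
      List.count_append]
    omega

theorem count_integ_not (c : Bool) (x : List ℕ) :
    (integ (!c) x).count 2 = (integ c x).count 1 ∧
      (integ (!c) x).count 1 = (integ c x).count 2 := by
  induction x generalizing c with
  | nil => simp
  | cons a x ih =>
    have h := ih (!c)
    simp only [integ, List.count_append, h, List.count_replicate]
    cases c <;> simp [letter]

theorem count_lift_le {s : List Bool} (hs : s.length = 4) {x : Word} (hx : IsWord x) :
    11 * (lift s x).count 2 ≤ 13 * (lift s x).count 1 + 28 ∧
      11 * (lift s x).count 1 ≤ 13 * (lift s x).count 2 + 28 := by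
  have key : ∀ {s : List Bool}, s.length = 4 →
      11 * (lift s x).count 2 ≤ 13 * (lift s x).count 1 + 28 := fun {s} hs => by
    have h1 := count_lift_add_potential hs hx
    have h2 := potential_le (act s x)
    omega
  refine ⟨key hs, ?_⟩
  rcases List.eq_nil_or_concat s with rfl | ⟨s, c, rfl⟩
  · simp at hs
  · rw [List.concat_eq_append]
    have h := key (s := s ++ [!c]) (by simpa using hs)
    rwa [lift_concat, (count_integ_not c _).1, (count_integ_not c _).2, ← lift_concat] at h

theorem exists_eq_lift_iterate (k : ℕ) : ∀ v ∈ Cinf, ∃ a s b, s.length = k ∧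
    v = a ++ lift s (D^[k] v) ++ b ∧ a.length < 2 ^ k ∧ b.length < 2 ^ k := by
  induction k with
  | zero => exact fun v _ => ⟨[], [], [], rfl, by simp [lift], by simp, by simp⟩
  | succ k ih =>
    intro v hv
    obtain ⟨a, s, b, hs, hD, ha, hb⟩ := ih (D v) (Cinf.deriv hv)
    obtain ⟨c, pre, post, hv', hpre, hpost⟩ := (Cinf.diffble hv).eq_integ_D
    have hpre' : pre.length ≤ 1 := by rcases hpre with rfl | rfl <;> simp
    have hpost' : post.length ≤ 1 := by rcases hpost with rfl | rfl <;> simp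
    have hw : IsWord (D v) := (Cinf.diffble (Cinf.deriv hv)).1
    have hsum : ∀ {x : Word}, IsWord x → x.sum ≤ 2 * x.length := fun hx => by
      rw [mul_comm]
      exact List.sum_le_card_nsmul _ 2 fun y hy => by rcases hx y hy with rfl | rfl <;> simp
    have ha' := hsum (hw.of_factor (v := a)
      ⟨[], lift s (D^[k] (D v)) ++ b, by rw [List.nil_append, ← List.append_assoc, ← hD]⟩)
    have hb' := hsum (hw.of_factor (v := b) (by rw [hD]; exact (List.suffix_append _ b).isInfix))
    refine ⟨pre ++ integ c a, s ++ [flips c a],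
      integ (flips c (a ++ lift s (D^[k] (D v)))) b ++ post, by simp [hs], ?_, ?_, ?_⟩
    · conv_lhs => rw [hv', hD]
      simp [integ_append, lift_concat, flips_append]
    · rw [List.length_append, length_integ, pow_succ]; omega
    · rw [List.length_append, length_integ, pow_succ]; omega

theorem IsWord.count_add_count {x : Word} (hx : IsWord x) :
    x.count 1 + x.count 2 = x.length ∧ x.sum = x.length + x.count 2 := by
  induction x with
  | nil => simp
  | cons a x ih =>
    have := ih (hx.of_factor (List.suffix_cons a x).isInfix)
    simp only [List.sum_cons, List.length_cons, List.count_cons]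
    rcases hx a (by simp) with rfl | rfl <;> simp <;> omega

/-- In `C∞`-words the letters `1` and `2` are almost balanced. -/
theorem Cinf.sum_bounds {v : Word} (hv : v ∈ Cinf) :
    24 * v.sum ≤ 37 * v.length + 358 ∧ 35 * v.length ≤ 24 * v.sum + 358 := by
  have hw := (Cinf.diffble hv).1.count_add_count
  obtain ⟨a, s, b, hs, he, ha, hb⟩ := exists_eq_lift_iterate 4 v hv
  have hc := count_lift_le hs (mem_Cinf_iff.1 hv 4).1
  have h2 : v.count 2 = a.count 2 + (lift s (D^[4] v)).count 2 + b.count 2 := by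
    conv_lhs => rw [he, List.count_append, List.count_append]
  have h1 : v.count 1 = a.count 1 + (lift s (D^[4] v)).count 1 + b.count 1 := by
    conv_lhs => rw [he, List.count_append, List.count_append]
  have := List.count_le_length (a := 1) (l := a)
  have := List.count_le_length (a := 2) (l := a)
  have := List.count_le_length (a := 1) (l := b)
  have := List.count_le_length (a := 2) (l := b)
  omega

theorem Cinf.length_lift_le {x : Word} (hx : x ∈ Cinf) (s : List Bool) :
    ((lift s x).length + 28 : ℝ) ≤ (37 / 24) ^ s.length * (x.length + 28) := by
  induction s generalizing x with
  | nil => simp [lift]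
  | cons c s ih =>
    refine (ih (integ_mem_Cinf hx c)).trans ?_
    rw [length_integ, List.length_cons, pow_succ, mul_assoc]
    gcongr
    have := (Cinf.sum_bounds hx).1
    have : (24 * x.sum : ℝ) ≤ 37 * x.length + 358 := by exact_mod_cast this
    linarith

theorem Cinf.exists_iterate_eq_nil_le {u : Word} (hu : u ∈ Cinf) :
    ∃ H ≤ u.length, D^[H] u = [] := by
  induction h : u.length using Nat.strong_induction_on generalizing u with
  | _ n ih =>
    by_cases h0 : u = []
    · exact ⟨0, by simp, h0⟩
    have hlt := (Cinf.diffble hu).length_D_lt h0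
    obtain ⟨H, hH, he⟩ := ih _ (h ▸ hlt) (Cinf.deriv hu) rfl
    exact ⟨H + 1, by omega, he⟩

/-- The height of a `C∞`-word is at most logarithmic in its length. -/
theorem Cinf.exists_iterate_eq_nil_pow_le {u : Word} (hu : u ∈ Cinf) (h0 : u ≠ []) :
    ∃ H, D^[H] u = [] ∧ ((35 / 24) ^ H : ℝ) ≤ (35 / 24) ^ 34 * u.length := by
  have key : ∀ n : ℕ, ∀ u ∈ Cinf, u.length = n → ∃ H, D^[H] u = [] ∧
      (((35 / 24) ^ H : ℝ) ≤ (35 / 24) ^ 33 ∨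
        ((35 / 24) ^ H : ℝ) ≤ (35 / 24) ^ 34 * (n - 33)) := by
    intro n
    induction n using Nat.strong_induction_on with
    | _ n ih =>
      intro u hu hn
      by_cases hle : n ≤ 33
      · obtain ⟨H, hH, he⟩ := Cinf.exists_iterate_eq_nil_le hu
        exact ⟨H, he, .inl (pow_le_pow_right₀ (by norm_num) (by omega))⟩
      have hne : u ≠ [] := by rintro rfl; simp at hn; omega
      have hd := Cinf.diffble hu
      obtain ⟨H, he, hH⟩ := ih _ (hn ▸ hd.length_D_lt hne) (D u) (Cinf.deriv hu) rfl
      refine ⟨H + 1, he, .inr ?_⟩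
      have h34 : (34 : ℝ) ≤ n := by exact_mod_cast (by omega : 34 ≤ n)
      have hlen : (35 * (D u).length : ℝ) ≤ 24 * n + 358 := by
        obtain ⟨c, pre, post, hu', -, -⟩ := hd.eq_integ_D
        have h1 := congrArg List.length hu'
        rw [List.length_append, List.length_append, length_integ] at h1
        have h2 := (Cinf.sum_bounds (Cinf.deriv hu)).2
        exact_mod_cast (by omega : 35 * (D u).length ≤ 24 * n + 358)
      have hA : (0 : ℝ) < (35 / 24) ^ 34 := by positivity
      rw [pow_succ]
      rcases hH with hH | hH
      · have h33 : ((35 / 24) ^ 34 : ℝ) = (35 / 24) ^ 33 * (35 / 24) := pow_succ _ _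
        nlinarith
      · nlinarith
  obtain ⟨H, he, hH⟩ := key _ u hu rfl
  have hpos : (1 : ℝ) ≤ u.length := by exact_mod_cast List.length_pos_iff.2 h0
  have hA : (0 : ℝ) < (35 / 24) ^ 34 := by positivity
  refine ⟨H, he, ?_⟩
  rcases hH with hH | hH
  · have h33 : ((35 / 24) ^ 34 : ℝ) = (35 / 24) ^ 33 * (35 / 24) := pow_succ _ _
    have : (0 : ℝ) < (35 / 24) ^ 33 := by positivity
    nlinarith
  · nlinarith

theorem exists_mem_Cinf_length_eq (n : ℕ) : ∃ X ∈ Cinf, X.length = n := by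
  have key : ∃ X ∈ Cinf, n ≤ X.length ∧ ∃ Y, X = 2 :: Y := by
    induction n with
    | zero =>
      refine ⟨[2], mem_Cinf_iff.2 ?_, by simp, [], rfl⟩
      have h2 : ∀ j, D^[j] [2] = [] ∨ D^[j] [2] = [2] := by
        intro j
        induction j with
        | zero => right; rfl
        | succ j ih =>
          left
          rw [Function.iterate_succ_apply']
          rcases ih with h | h <;> rw [h] <;> rfl
      intro j
      rcases h2 j with h | h <;> rw [h]
      · exact ⟨by simp [IsWord], by simp [IsWord, rle]⟩
      · exact diffble_integ (c := true) (x := [1]) (by simp [IsWord])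
    | succ n ih =>
      obtain ⟨X, hX, hn, Y, rfl⟩ := ih
      have hw := (Cinf.diffble hX).1
      have := (hw.of_factor (List.suffix_cons 2 Y).isInfix).length_le_sum
      refine ⟨integ true (2 :: Y), integ_mem_Cinf hX true, ?_, 2 :: integ false Y, rfl⟩
      rw [length_integ, List.sum_cons]
      rw [List.length_cons] at hn
      omega
  obtain ⟨X, hX, hn, -⟩ := key
  exact ⟨X.take n, Cinf.of_factor hX ⟨[], X.drop n, by simp⟩, by simpa using hn⟩

/-- The exponent of the polynomial bound on the distance between two occurrences. -/
noncomputable def returnExponent : ℝ := Real.logb (35 / 24) (37 / 12)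

theorem returnExponent_lt : returnExponent < 3 := by
  rw [returnExponent, Real.logb_lt_iff_lt_rpow (by norm_num) (by norm_num)]
  norm_num

theorem returnExponent_nonneg : 0 ≤ returnExponent :=
  Real.logb_nonneg (by norm_num) (by norm_num)

theorem exists_return_length_le {u : Word} (hu : u ∈ Cinf) (h0 : u ≠ []) :
    ∃ z, IsWord z ∧ u ++ z ++ u ∈ Cinf ∧
      (z.length : ℝ) ≤ 40 * ((35 / 24) ^ 34 * u.length) ^ returnExponent := by
  obtain ⟨H, hH, hle⟩ := Cinf.exists_iterate_eq_nil_pow_le hu h0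
  obtain ⟨X, hX, hlen⟩ := exists_mem_Cinf_length_eq (6 * 2 ^ H + 6)
  obtain ⟨s, z, hs, hz⟩ := exists_return hu hH hX hlen
  have hmem := Cinf.of_factor (lift_mem_Cinf hX s) hz
  refine ⟨z, (Cinf.diffble hmem).1.of_factor ⟨u, u, rfl⟩, hmem, ?_⟩
  have h1 : (z.length : ℝ) ≤ (lift s X).length := by
    have := hz.length_le
    simp only [List.length_append] at this
    exact_mod_cast (by omega : z.length ≤ (lift s X).length)
  have h2 := Cinf.length_lift_le hX s
  rw [hs, hlen] at h2
  push_cast at h2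
  have h3 : ((37 / 24) ^ H * (6 * 2 ^ H + 6 + 28) : ℝ) ≤ 40 * (37 / 12) ^ H := by
    have : ((37 / 12) ^ H : ℝ) = (37 / 24) ^ H * 2 ^ H := by rw [← mul_pow]; norm_num
    rw [this]
    have h2H : (1 : ℝ) ≤ 2 ^ H := one_le_pow₀ (by norm_num)
    have : (0 : ℝ) < (37 / 24) ^ H := by positivity
    nlinarith
  have h4 : ((37 / 12) ^ H : ℝ) = ((35 / 24) ^ H) ^ returnExponent := by
    rw [← Real.rpow_natCast (35 / 24), ← Real.rpow_mul (by norm_num), mul_comm,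
      Real.rpow_mul (by norm_num), returnExponent,
      Real.rpow_logb (by norm_num) (by norm_num) (by norm_num), Real.rpow_natCast]
  have h5 := Real.rpow_le_rpow (by positivity) hle returnExponent_nonneg
  rw [← h4] at h5
  linarith

end CinftyWords

open CinftyWords in
/-- `G` is well defined (the minimum exists for every `n ≥ 1`) and `G(n) = o(n³)`. -/
theorem G_well_defined_and_little_o_cubic :
    (∀ n : ℕ, 1 ≤ n →
      {k : ℕ | ∀ u ∈ Cinf, u.length = n →
        ∃ z : Word, IsWord z ∧ z.length ≤ k ∧ u ++ z ++ u ∈ Cinf}.Nonempty) ∧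
    Filter.Tendsto (fun n : ℕ => (G n : ℝ) / (n : ℝ) ^ 3) Filter.atTop (nhds 0) := by
  have hmem : ∀ n : ℕ, 1 ≤ n →
      ⌊40 * ((35 / 24 : ℝ) ^ 34 * n) ^ returnExponent⌋₊ ∈
      {k : ℕ | ∀ u ∈ Cinf, u.length = n →
        ∃ z : Word, IsWord z ∧ z.length ≤ k ∧ u ++ z ++ u ∈ Cinf} := by
    intro n hn u hu hlen
    obtain ⟨z, hz, hmem, hle⟩ := exists_return_length_le hu (by rintro rfl; simp at hlen; omega)
    exact ⟨z, hz, Nat.le_floor (by rwa [hlen] at hle), hmem⟩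
  refine ⟨fun n hn => ⟨_, hmem n hn⟩, ?_⟩
  have hlim : Filter.Tendsto (fun n : ℕ => 40 * ((35 / 24 : ℝ) ^ 34) ^ returnExponent *
      (n : ℝ) ^ (-(3 - returnExponent))) Filter.atTop (nhds 0) := by
    have := ((tendsto_rpow_neg_atTop (sub_pos.2 returnExponent_lt)).comp
      tendsto_natCast_atTop_atTop).const_mul (40 * ((35 / 24 : ℝ) ^ 34) ^ returnExponent)
    simpa using this
  refine squeeze_zero' (.of_forall fun n => by positivity) ?_ hlim
  filter_upwards [Filter.eventually_ge_atTop 1] with n hn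
  have hn0 : (0 : ℝ) < n := by exact_mod_cast hn
  have hG : (G n : ℝ) ≤ 40 * ((35 / 24 : ℝ) ^ 34 * n) ^ returnExponent :=
    (Nat.cast_le.2 (Nat.sInf_le (hmem n hn))).trans (Nat.floor_le (by positivity))
  rw [Real.mul_rpow (by positivity) hn0.le] at hG
  rw [div_le_iff₀ (by positivity), mul_assoc, ← Real.rpow_natCast (n : ℝ), ← Real.rpow_add hn0]
  refine hG.trans (le_of_eq ?_)
  rw [mul_assoc]
  congr 3
  push_cast
  ring
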